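/- If X is a Hausdorff space with a π-base whose elements have H-closed closures, then d_θ(X) ≤ 2^(ψ_c(X)·t(X)·wL(X)). -/

import Mathlib

open Cardinal Set

universe u

section Defs
variable (X : Type u) [TopologicalSpace X]

/-- An open cover of the whole space. -/
def IsOpenCover (𝒰 : Set (Set X)) : Prop := (∀ U ∈ 𝒰, IsOpen U) ∧ ⋃₀ 𝒰 = Set.univ

/-- The cellularity: supremum of cardinalities of pairwise disjoint families of nonempty
open sets, plus `ℵ₀`. -/
noncomputable def cellularity : Cardinal.{u} :=
  max ℵ₀ (⨆ 𝒰 : {𝒰 : Set (Set X) // (∀ U ∈ 𝒰, IsOpen U ∧ U.Nonempty) ∧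
    𝒰.PairwiseDisjoint id}, #𝒰.1)

/-- The weak Lindelöf degree. -/
noncomputable def wLdeg : Cardinal.{u} :=
  sInf {κ | ℵ₀ ≤ κ ∧ ∀ 𝒰 : Set (Set X), IsOpenCover X 𝒰 →
    ∃ 𝒱 ⊆ 𝒰, #𝒱 ≤ κ ∧ Dense (⋃₀ 𝒱)}

/-- The tightness. -/
noncomputable def tightness : Cardinal.{u} :=
  sInf {κ | ℵ₀ ≤ κ ∧ ∀ (A : Set X) (x : X), x ∈ closure A →
    ∃ B ⊆ A, #B ≤ κ ∧ x ∈ closure B}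

/-- The π-character. -/
noncomputable def piCharacter : Cardinal.{u} :=
  sInf {κ | ℵ₀ ≤ κ ∧ ∀ x : X, ∃ 𝒬 : Set (Set X), #𝒬 ≤ κ ∧
    (∀ P ∈ 𝒬, IsOpen P ∧ P.Nonempty) ∧
    ∀ U : Set X, IsOpen U → x ∈ U → ∃ P ∈ 𝒬, P ⊆ U}

/-- The pseudocharacter. -/
noncomputable def pseudoChar : Cardinal.{u} :=
  sInf {κ | ℵ₀ ≤ κ ∧ ∀ x : X, ∃ 𝒱 : Set (Set X), #𝒱 ≤ κ ∧
    (∀ V ∈ 𝒱, IsOpen V ∧ x ∈ V) ∧ ⋂₀ 𝒱 = {x}}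

/-- The closed pseudocharacter. -/
noncomputable def closedPseudoChar : Cardinal.{u} :=
  sInf {κ | ℵ₀ ≤ κ ∧ ∀ x : X, ∃ 𝒱 : Set (Set X), #𝒱 ≤ κ ∧
    (∀ V ∈ 𝒱, IsOpen V ∧ x ∈ V) ∧ (⋂ V ∈ 𝒱, closure V) = {x}}

/-- The density. -/
noncomputable def densityCard : Cardinal.{u} :=
  sInf {κ | ℵ₀ ≤ κ ∧ ∃ D : Set X, #D ≤ κ ∧ Dense D}

/-- The star of a set `A` with respect to a family `𝒰`. -/
def st (A : Set X) (𝒰 : Set (Set X)) : Set X := ⋃₀ {U | U ∈ 𝒰 ∧ (A ∩ U).Nonempty}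

/-- The θ-closure of a set. -/
def thetaClosure (A : Set X) : Set X :=
  {x | ∀ U : Set X, IsOpen U → x ∈ U → (closure U ∩ A).Nonempty}

/-- The θ-density. -/
noncomputable def thetaDensityCard : Cardinal.{u} :=
  sInf {κ | ℵ₀ ≤ κ ∧ ∃ D : Set X, #D ≤ κ ∧ thetaClosure X D = Set.univ}

/-- A discrete family of sets: each point has a neighborhood meeting at most one member. -/
def IsDiscreteFamily (𝒰 : Set (Set X)) : Prop :=
  ∀ x : X, ∃ V : Set X, IsOpen V ∧ x ∈ V ∧ {U | U ∈ 𝒰 ∧ (V ∩ U).Nonempty}.Subsingleton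

/-- Countable discrete cellularity. -/
def CDC : Prop :=
  ∀ 𝒰 : Set (Set X), (∀ U ∈ 𝒰, IsOpen U ∧ U.Nonempty) → IsDiscreteFamily X 𝒰 → 𝒰.Countable

/-- Star-cdc: every open cover has a cdc subspace whose star covers the space. -/
def StarCDC : Prop :=
  ∀ 𝒰 : Set (Set X), IsOpenCover X 𝒰 → ∃ Y : Set X, CDC ↥Y ∧ st X Y 𝒰 = Set.univ

/-- H-closed space: every open cover has a finite subfamily with dense union. -/
def IsHClosedSpace : Prop :=
  ∀ 𝒰 : Set (Set X), IsOpenCover X 𝒰 → ∃ 𝒱 ⊆ 𝒰, 𝒱.Finite ∧ Dense (⋃₀ 𝒱)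

/-- Countable cellularity (ccc). -/
def CCCSpace : Prop :=
  ∀ 𝒰 : Set (Set X), (∀ U ∈ 𝒰, IsOpen U ∧ U.Nonempty) → 𝒰.PairwiseDisjoint id → 𝒰.Countable

/-- Weakly Lindelöf space. -/
def WeaklyLindelof : Prop :=
  ∀ 𝒰 : Set (Set X), IsOpenCover X 𝒰 → ∃ 𝒱 ⊆ 𝒰, 𝒱.Countable ∧ Dense (⋃₀ 𝒱)

/-- Almost Lindelöf space. -/
def AlmostLindelof : Prop :=
  ∀ 𝒰 : Set (Set X), IsOpenCover X 𝒰 → ∃ 𝒱 ⊆ 𝒰, 𝒱.Countable ∧ (⋃ V ∈ 𝒱, closure V) = Set.univ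

/-- A π-base: a family of nonempty open sets such that every nonempty open set contains one. -/
def IsPiBase (ℬ : Set (Set X)) : Prop :=
  (∀ B ∈ ℬ, IsOpen B ∧ B.Nonempty) ∧
  ∀ U : Set X, IsOpen U → U.Nonempty → ∃ B ∈ ℬ, B ⊆ U

/-- Power homogeneous: some power of `X` is homogeneous. -/
def PowerHomogeneous : Prop :=
  ∃ ι : Type u, ∀ x y : ι → X, ∃ h : (ι → X) ≃ₜ (ι → X), h x = y

/-- A strong `G_δ`-diagonal of rank 2. -/
def HasStrongRank2Diagonal : Prop :=
  ∃ 𝒰 : ℕ → Set (Set X), (∀ n, IsOpenCover X (𝒰 n)) ∧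
    ∀ x : X, (⋂ n, closure (st X (st X {x} (𝒰 n)) (𝒰 n))) = {x}

/-- A `G_δ`-diagonal of rank 2. -/
def HasRank2Diagonal : Prop :=
  ∃ 𝒰 : ℕ → Set (Set X), (∀ n, IsOpenCover X (𝒰 n)) ∧
    ∀ x : X, (⋂ n, st X (st X {x} (𝒰 n)) (𝒰 n)) = {x}

/-- A `G_δ`-diagonal of rank 3. -/
def HasRank3Diagonal : Prop :=
  ∃ 𝒰 : ℕ → Set (Set X), (∀ n, IsOpenCover X (𝒰 n)) ∧
    ∀ x : X, (⋂ n, st X (st X (st X {x} (𝒰 n)) (𝒰 n)) (𝒰 n)) = {x}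

/-- Basically disconnected: the closure of every cozero set is open. -/
def BasicallyDisconnected : Prop :=
  ∀ f : C(X, ℝ), IsOpen (closure {x | f x ≠ 0})

end Defs

open Filter Topology

theorem power_two_power_self {κ : Cardinal.{u}} (h : ℵ₀ ≤ κ) :
    ((2 : Cardinal.{u}) ^ κ) ^ κ = 2 ^ κ := by
  rw [← power_mul, mul_eq_self h]

/-- Closing off a point under `2 ^ #ι` many operations of arity `ι`. -/
theorem exists_closed_under_operations {ι J α : Type u} [Infinite ι] (hJ : #J ≤ 2 ^ #ι) (a₀ : α)
    (e : (ι → α) → J → α) :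
    ∃ B : Set α, a₀ ∈ B ∧ #B ≤ 2 ^ #ι ∧ ∀ f : ι → α, (∀ i, f i ∈ B) → ∀ j, e f j ∈ B := by
  have hι : ℵ₀ ≤ #ι := aleph0_le_mk ι
  let β : Option J → Type u := fun o => o.elim PEmpty fun _ => ι
  let decode : WType β → α := fun w => WType.elim α
    (fun x : Σ o : Option J, β o → α =>
      match x with
      | ⟨none, _⟩ => a₀
      | ⟨some j, g⟩ => e g j) w
  refine ⟨range decode, ⟨WType.mk none (fun x => x.elim), rfl⟩, mk_range_le.trans ?_, ?_⟩
  · apply WType.cardinalMk_le_of_le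
    have hp : ℵ₀ ≤ (2 : Cardinal.{u}) ^ #ι := hι.trans (cantor _).le
    have hO : #(Option J) ≤ 2 ^ #ι := by
      rw [mk_option]
      exact add_le_of_le hp hJ (one_le_aleph0.trans hp)
    calc
      (Cardinal.sum fun o : Option J => (2 ^ #ι) ^ #(β o))
          ≤ Cardinal.sum fun _ : Option J => (2 : Cardinal.{u}) ^ #ι := by
        refine sum_le_sum _ _ fun o => ?_
        cases o with
        | none =>
          have : #(β none) = 0 := mk_eq_zero PEmpty
          rw [this, power_zero]
          exact one_le_aleph0.trans hp
        | some j => exact (power_two_power_self hι).le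
      _ = #(Option J) * 2 ^ #ι := by rw [sum_const']
      _ ≤ 2 ^ #ι * 2 ^ #ι := mul_le_mul_left hO _
      _ = 2 ^ #ι := mul_eq_self hp
  · intro f hf j
    choose g hg using hf
    refine ⟨WType.mk (some j) g, ?_⟩
    have : f = fun i => decode (g i) := funext fun i => (hg i).symm
    rw [this]
    rfl

/-- The filter of sets with dense interior. -/
def denseInteriorFilter (X : Type u) [TopologicalSpace X] : Filter X where
  sets := {S | Dense (interior S)}
  univ_sets := by simp
  sets_of_superset h hs := h.mono (interior_mono hs)
  inter_sets h h' := by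
    simp only [mem_ofPred_eq, interior_inter] at *
    exact h.inter_of_isOpen_left h' isOpen_interior

theorem mem_denseInteriorFilter {X : Type u} [TopologicalSpace X] {S : Set X} :
    S ∈ denseInteriorFilter X ↔ Dense (interior S) := Iff.rfl

theorem IsHClosedSpace.exists_le_nhds {X : Type u} [TopologicalSpace X] (h : IsHClosedSpace X)
    (z : Ultrafilter X) (hz : (z : Filter X) ≤ denseInteriorFilter X) :
    ∃ p, (z : Filter X) ≤ 𝓝 p := by
  by_contra! hcon
  have h1 : ∀ p, ∃ U : Set X, IsOpen U ∧ p ∈ U ∧ U ∉ z := by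
    intro p
    by_contra! h2
    refine hcon p fun S hS => ?_
    obtain ⟨U, hUS, hU, hpU⟩ := mem_nhds_iff.1 hS
    exact mem_of_superset (h2 U hU hpU) hUS
  choose U hU hpU hUz using h1
  obtain ⟨𝒱, h𝒱, hfin, hd⟩ := h (range U)
    ⟨by rintro _ ⟨p, rfl⟩; exact hU p, eq_univ_of_forall fun p => ⟨U p, ⟨p, rfl⟩, hpU p⟩⟩
  have hopen : IsOpen (⋃₀ 𝒱) := isOpen_sUnion fun V hV => by
    obtain ⟨p, rfl⟩ := h𝒱 hV
    exact hU p
  have hmem : ⋃₀ 𝒱 ∈ z := hz (mem_denseInteriorFilter.2 (by rwa [hopen.interior_eq]))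
  obtain ⟨V, hV, hVz⟩ := (Ultrafilter.finite_sUnion_mem_iff hfin).1 hmem
  obtain ⟨p, rfl⟩ := h𝒱 hV
  exact hUz p hVz

theorem exists_ultrafilter_le_nhds_le_denseInterior {X : Type u} [TopologicalSpace X] (p : X) :
    ∃ z : Ultrafilter X, (z : Filter X) ≤ 𝓝 p ∧ (z : Filter X) ≤ denseInteriorFilter X := by
  have : NeBot (𝓝 p ⊓ denseInteriorFilter X) := by
    rw [inf_neBot_iff]
    intro S hS T hT
    obtain ⟨U, hUS, hU, hpU⟩ := mem_nhds_iff.1 hS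
    obtain ⟨x, hxU, hxT⟩ := (mem_denseInteriorFilter.1 hT).inter_open_nonempty U hU ⟨p, hpU⟩
    exact ⟨x, hUS hxU, interior_subset hxT⟩
  exact ⟨Ultrafilter.of _, (Ultrafilter.of_le _).trans inf_le_left,
    (Ultrafilter.of_le _).trans inf_le_right⟩

/-- **Dow–Porter**: an H-closed space whose closed pseudocharacter is at most `#ι` has at most
`2 ^ #ι` points. -/
theorem IsHClosedSpace.mk_le_two_power {X : Type u} [TopologicalSpace X]
    (h : IsHClosedSpace X) {ι : Type u} [Infinite ι] (V : X → ι → Set X)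
    (hVo : ∀ x i, IsOpen (V x i)) (hVm : ∀ x i, x ∈ V x i)
    (hV : ∀ x y, (∀ i, y ∈ closure (V x i)) → y = x) : #X ≤ 2 ^ #ι := by
  classical
  have hι : ℵ₀ ≤ #ι := aleph0_le_mk ι
  rcases isEmpty_or_nonempty X with hX | ⟨⟨x₀⟩⟩
  · rw [mk_eq_zero]
    exact zero_le
  let Z := {z : Ultrafilter X // (z : Filter X) ≤ denseInteriorFilter X}
  choose lim hlim using fun z : Z => h.exists_le_nhds z.1 z.2
  choose σ hσ hσ' using exists_ultrafilter_le_nhds_le_denseInterior (X := X)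
  have hlim_eq : ∀ (z : Z) (p : X), (∀ i, V p i ∈ z.1) → lim z = p := by
    refine fun z p hz => hV p _ fun i => mem_closure_iff_ultrafilter.2 ⟨z.1, hz i, hlim z⟩
  have hlim_mem : ∀ (z : Z) i, V (lim z) i ∈ z.1 := fun z i =>
    hlim z ((hVo _ i).mem_nhds (hVm _ i))
  let glue : {I : Type u} → Ultrafilter I → (I → Z) → Z := fun {I} u a =>
    ⟨u.bind fun i => (a i).1, fun S hS =>
      Filter.mem_bind'.2 (Eventually.of_forall fun i => (a i).2 hS)⟩
  have mem_glue : ∀ {I : Type u} (u : Ultrafilter I) (a : I → Z) (S : Set X),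
      S ∈ (glue u a).1 ↔ ∀ᶠ i in (u : Filter I), S ∈ (a i).1 := fun u a S => Filter.mem_bind'
  let z₀ : Z := ⟨σ x₀, hσ' x₀⟩
  let avoid : Set (Set X) → Z := fun 𝒲 =>
    if hW : ∃ z : Z, ∀ W ∈ 𝒲, W ∉ z.1 then hW.choose else z₀
  have havoid : ∀ 𝒲 : Set (Set X), (∃ z : Z, ∀ W ∈ 𝒲, W ∉ z.1) →
      ∀ W ∈ 𝒲, W ∉ (avoid 𝒲).1 := by
    intro 𝒲 hW
    simp only [avoid, dif_pos hW]
    exact hW.choose_spec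
  let op : (Finset ι → Z) → Option (Finset (Finset ι × ι)) → Z := fun a o =>
    o.elim (glue (Ultrafilter.of atTop) a)
      fun t => avoid ((fun q : Finset ι × ι => V (lim (a q.1)) q.2) '' t)
  have hfin : #(Finset ι) = #ι := mk_finset_of_infinite ι
  obtain ⟨B, hz₀, hB, hcl⟩ := exists_closed_under_operations (ι := Finset ι)
    (by
      rw [mk_option, mk_finset_of_infinite, mk_prod, lift_id, lift_id, hfin, mul_eq_self hι,
        add_one_eq hι]
      exact (cantor _).le) z₀ op
  rw [hfin] at hB
  suffices hsurj : ∀ q, ∃ z ∈ B, lim z = q by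
    refine le_trans (mk_le_of_surjective (f := fun z : B => lim z) fun q => ?_) hB
    obtain ⟨z, hz, rfl⟩ := hsurj q
    exact ⟨⟨z, hz⟩, rfl⟩
  intro q
  by_contra! hq
  have hi : ∀ z : B, ∃ i, q ∉ closure (V (lim z) i) := by
    intro z
    by_contra! hc
    exact hq z z.2 (hV _ _ hc).symm
  choose i hi using hi
  have hσV : ∀ z : B, V (lim z) (i z) ∉ σ q := fun z hz =>
    hi z (mem_closure_iff_ultrafilter.2 ⟨σ q, hz, hσ q⟩)
  have hb : ∀ t : Finset B, ∃ b ∈ B, ∀ z ∈ t, V (lim z) (i z) ∉ b.1 := by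
    intro t
    obtain ⟨g⟩ : Nonempty (t ↪ Finset ι) :=
      (mk_lt_aleph0 (α := t)).le.trans (hι.trans hfin.ge)
    let a : Finset ι → Z := fun F => if hF : ∃ z : t, g z = F then (hF.choose : B) else z₀
    have ha : ∀ F, a F ∈ B := by
      intro F
      simp only [a]
      split_ifs with hF
      · exact (hF.choose : B).2
      · exact hz₀
    have hag : ∀ z : t, a (g z) = (z : B) := by
      intro z
      have hF : ∃ z' : t, g z' = g z := ⟨z, rfl⟩
      have := g.injective hF.choose_spec
      simp only [a, dif_pos hF]
      rw [this]
    let s : Finset (Finset ι × ι) := Finset.univ.image fun z : t => (g z, i z)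
    refine ⟨op a (some s), hcl a ha _, fun z hz => ?_⟩
    refine havoid _ ⟨⟨σ q, hσ' q⟩, ?_⟩ _ ?_
    · rintro _ ⟨w, hw, rfl⟩
      obtain ⟨z', -, rfl⟩ := Finset.mem_image.1 (Finset.mem_coe.1 hw)
      simp only [hag]
      exact hσV z'
    · refine ⟨(g ⟨z, hz⟩, i z), Finset.mem_coe.2 (Finset.mem_image.2 ⟨⟨z, hz⟩, by simp, rfl⟩), ?_⟩
      simp only [hag]
  choose b hbB hb using hb
  let y : Z := glue (Ultrafilter.of atTop) b
  have hy : ∀ F : Finset ι, ∃ t, ∀ j ∈ F, V (lim y) j ∈ (b t).1 := fun F =>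
    ((eventually_all_finset F).2 fun j _ => (mem_glue _ b _).1 (hlim_mem y j)).exists
  choose τ hτ using hy
  have hcB : op (fun F => b (τ F)) none ∈ B := hcl _ (fun F => hbB _) none
  have hlimc : lim (op (fun F => b (τ F)) none) = lim y := by
    refine hlim_eq _ _ fun j => (mem_glue _ _ _).2 (Ultrafilter.of_le _ ?_)
    filter_upwards [eventually_ge_atTop {j}] with F hF
    exact hτ F j (hF (Finset.mem_singleton_self j))
  let c : B := ⟨_, hcB⟩
  have h1 : ∀ᶠ t in (Ultrafilter.of (atTop : Filter (Finset B)) : Filter (Finset B)),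
      V (lim c) (i c) ∈ (b t).1 := by
    refine (mem_glue _ b _).1 ?_
    have : lim c = lim y := hlimc
    rw [this]
    exact hlim_mem y _
  have h2 : ∀ᶠ t in (Ultrafilter.of (atTop : Filter (Finset B)) : Filter (Finset B)), c ∈ t := by
    refine Ultrafilter.of_le _ ?_
    filter_upwards [eventually_ge_atTop {c}] with t ht
    exact ht (Finset.mem_singleton_self c)
  obtain ⟨t, ht, ht'⟩ := (h1.and h2).exists
  exact hb t c ht' ht

theorem exists_range_eq_of_mk_le {X ι : Type u} {A : Set X} (hA : A.Nonempty) (h : #A ≤ #ι) :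
    ∃ f : ι → X, range f = A := by
  obtain ⟨g⟩ := h
  have := hA.to_subtype
  refine ⟨fun i => (Function.invFun g i : A), ?_⟩
  ext x
  constructor
  · rintro ⟨i, rfl⟩
    exact Subtype.coe_prop _
  · exact fun hx => ⟨g ⟨x, hx⟩, by simp only [Function.leftInverse_invFun g.injective ⟨x, hx⟩]⟩

theorem mk_closure_le_two_power {X : Type u} [TopologicalSpace X] {ι : Type u} [Infinite ι]
    (V : X → ι → Set X) (hVo : ∀ x i, IsOpen (V x i)) (hVm : ∀ x i, x ∈ V x i)
    (hV : ∀ x y, (∀ i, y ∈ closure (V x i)) → y = x)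
    (ht : ∀ (A : Set X) (x : X), x ∈ closure A → ∃ B ⊆ A, #B ≤ #ι ∧ x ∈ closure B)
    (A : Set X) (hA : #A ≤ 2 ^ #ι) : #(closure A) ≤ 2 ^ #ι := by
  have hι : ℵ₀ ≤ #ι := aleph0_le_mk ι
  have key : ∀ x : closure A, ∃ g : ι → ι → A, ∀ i,
      (∀ j, (g i j : X) ∈ V x i) ∧ (x : X) ∈ closure (range fun j => (g i j : X)) := by
    rintro ⟨x, hx⟩
    obtain ⟨C, hCA, hC, hxC⟩ := ht A x hx
    have h1 : ∀ i, ∃ f : ι → A, (∀ j, (f j : X) ∈ V x i) ∧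
        x ∈ closure (range fun j => (f j : X)) := by
      intro i
      have hxi : x ∈ closure (V x i ∩ C) := by
        rw [mem_closure_iff] at hxC ⊢
        intro O hO hxO
        obtain ⟨y, hy, hyC⟩ := hxC (O ∩ V x i) (hO.inter (hVo x i)) ⟨hxO, hVm x i⟩
        exact ⟨y, hy.1, hy.2, hyC⟩
      obtain ⟨f, hf⟩ := exists_range_eq_of_mk_le (closure_nonempty_iff.1 ⟨x, hxi⟩)
        ((mk_le_mk_of_subset inter_subset_right).trans hC)
      have hf' : ∀ j, f j ∈ V x i ∩ C := fun j => hf ▸ mem_range_self j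
      exact ⟨fun j => ⟨f j, hCA (hf' j).2⟩, fun j => (hf' j).1, by simpa only [hf]⟩
    choose g hg using h1
    exact ⟨g, hg⟩
  choose g hg using key
  have hinj : Function.Injective g := by
    intro x y hxy
    refine Subtype.ext (hV _ _ fun i => ?_)
    refine closure_mono ?_ (hg x i).2
    rintro _ ⟨j, rfl⟩
    rw [hxy]
    exact (hg y i).1 j
  calc
    #(closure A) ≤ #(ι → ι → A) := mk_le_of_injective hinj
    _ = (#A ^ #ι) ^ #ι := by simp
    _ ≤ ((2 ^ #ι) ^ #ι) ^ #ι := power_le_power_right (power_le_power_right hA)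
    _ = 2 ^ #ι := by rw [power_two_power_self hι, power_two_power_self hι]

/-- A point outside an H-closed regular closed set has a neighbourhood, among finite
intersections from its pseudobase, which misses the interior part. -/
theorem IsHClosedSpace.exists_finset_disjoint {X : Type u} [TopologicalSpace X] {B : Set X}
    (hB : IsOpen B) (h : IsHClosedSpace ↥(closure B)) {ι : Type u} (W : ι → Set X)
    (hWo : ∀ i, IsOpen (W i)) {y : X}
    (hW : ∀ z, (∀ i, z ∈ closure (W i)) → z = y) (hy : y ∉ closure B) :
    ∃ t : Finset ι, Disjoint (⋂ i ∈ t, W i) B := by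
  classical
  let O : ι → Set ↥(closure B) := fun i => Subtype.val ⁻¹' (closure (W i))ᶜ
  obtain ⟨𝒱, h𝒱, hfin, hd⟩ := h (range O) ⟨by
      rintro _ ⟨i, rfl⟩
      exact isClosed_closure.isOpen_compl.preimage continuous_subtype_val, by
      refine eq_univ_of_forall fun z => ?_
      by_contra hz
      have hzy : (z : X) = y := hW z fun i => by
        by_contra hi
        exact hz ⟨O i, ⟨i, rfl⟩, hi⟩
      exact hy (hzy ▸ z.2)⟩
  choose k hk using h𝒱
  refine ⟨hfin.toFinset.attach.image fun S => k (hfin.mem_toFinset.1 S.2), ?_⟩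
  rw [Set.disjoint_left]
  intro b hbW hbB
  set t := hfin.toFinset.attach.image fun S => k (hfin.mem_toFinset.1 S.2)
  have hopen : IsOpen ((⋂ i ∈ t, W i) ∩ B) :=
    (isOpen_biInter_finset fun i _ => hWo i).inter hB
  obtain ⟨x, ⟨hxW, -⟩, S, hS, hxS⟩ := hd.inter_open_nonempty _
    (hopen.preimage continuous_subtype_val) ⟨⟨b, subset_closure hbB⟩, hbW, hbB⟩
  have hkt : k hS ∈ t :=
    Finset.mem_image.2 ⟨⟨S, hfin.mem_toFinset.2 hS⟩, Finset.mem_attach _ _, rfl⟩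
  rw [← hk hS] at hxS
  exact hxS (subset_closure (mem_iInter₂.1 hxW _ hkt))

theorem IsHClosedSpace.mk_subtype_le_two_power {X : Type u} [TopologicalSpace X] {A : Set X}
    (h : IsHClosedSpace ↥A) {ι : Type u} [Infinite ι] (V : X → ι → Set X)
    (hVo : ∀ x i, IsOpen (V x i)) (hVm : ∀ x i, x ∈ V x i)
    (hV : ∀ x y, (∀ i, y ∈ closure (V x i)) → y = x) : #A ≤ 2 ^ #ι :=
  h.mk_le_two_power (fun x i => Subtype.val ⁻¹' V x i)
    (fun x i => (hVo x i).preimage continuous_subtype_val) (fun x i => hVm x i)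
    fun x y hy => Subtype.ext <| hV x y fun i =>
      continuous_subtype_val.closure_preimage_subset _ (hy i)

theorem exists_thetaClosure_eq_univ {X : Type u} [TopologicalSpace X] {ℬ : Set (Set X)}
    (hB : IsPiBase X ℬ) (hc : ∀ B ∈ ℬ, IsHClosedSpace ↥(closure B)) {ι : Type u} [Infinite ι]
    (V : X → ι → Set X) (hVo : ∀ x i, IsOpen (V x i)) (hVm : ∀ x i, x ∈ V x i)
    (hV : ∀ x y, (∀ i, y ∈ closure (V x i)) → y = x)
    (ht : ∀ (A : Set X) (x : X), x ∈ closure A → ∃ B ⊆ A, #B ≤ #ι ∧ x ∈ closure B)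
    (hw : ∀ 𝒰 : Set (Set X), IsOpenCover X 𝒰 → ∃ 𝒱 ⊆ 𝒰, #𝒱 ≤ #ι ∧ Dense (⋃₀ 𝒱)) :
    ∃ D : Set X, #D ≤ 2 ^ #ι ∧ thetaClosure X D = Set.univ := by
  classical
  have hι : ℵ₀ ≤ #ι := aleph0_le_mk ι
  have hp : ℵ₀ ≤ (2 : Cardinal.{u}) ^ #ι := hι.trans (cantor _).le
  rcases isEmpty_or_nonempty X with hX | ⟨⟨x₀⟩⟩
  · exact ⟨∅, by simp, eq_univ_of_forall isEmptyElim⟩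
  have hBcard : ∀ B ∈ ℬ, #B ≤ 2 ^ #ι := fun B hB =>
    (mk_le_mk_of_subset subset_closure).trans
      ((hc B hB).mk_subtype_le_two_power V hVo hVm hV)
  have hUcard : ∀ 𝒞 : Set ℬ, #𝒞 ≤ 2 ^ #ι → #(closure (⋃ B ∈ 𝒞, (B : Set X))) ≤ 2 ^ #ι := by
    intro 𝒞 h𝒞
    refine mk_closure_le_two_power V hVo hVm hV ht _ ?_
    refine (mk_biUnion_le _ _).trans ?_
    refine (mul_le_mul' h𝒞 (ciSup_le' fun B => hBcard _ B.1.2)).trans ?_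
    rw [mul_eq_self hp]
  obtain ⟨B₀, hB₀, -⟩ := hB.2 univ isOpen_univ ⟨x₀, trivial⟩
  have hen : ∀ c : ι → ℬ, ∃ e : Set ι → X, closure (⋃ B ∈ range c, (B : Set X)) ⊆ range e := by
    intro c
    obtain ⟨e, he⟩ := exists_range_eq_of_mk_le (ι := Set ι)
      (A := closure (⋃ B ∈ range c, (B : Set X)))
      (by
        obtain ⟨i⟩ : Nonempty ι := inferInstance
        obtain ⟨x, hx⟩ := (hB.1 _ (c i).2).2
        exact ⟨x, subset_closure (mem_biUnion (mem_range_self i) hx)⟩)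
      (by
        rw [mk_set]
        exact hUcard _ (mk_range_le.trans (cantor _).le))
    exact ⟨e, he.ge⟩
  choose en hen using hen
  have hav : ∀ S : Set X, ∃ B : ℬ, (closure S)ᶜ.Nonempty → (B : Set X) ⊆ (closure S)ᶜ := by
    intro S
    by_cases hS : (closure S)ᶜ.Nonempty
    · obtain ⟨B, hB, hBS⟩ := hB.2 _ isClosed_closure.isOpen_compl hS
      exact ⟨⟨B, hB⟩, fun _ => hBS⟩
    · exact ⟨⟨B₀, hB₀⟩, fun h => absurd h hS⟩
  choose avoid havoid using hav
  let nb : X → Finset ι → Set X := fun x t => ⋂ i ∈ t, V x i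
  have hnbo : ∀ x t, IsOpen (nb x t) := fun x t => isOpen_biInter_finset fun i _ => hVo x i
  have hnbm : ∀ x t, x ∈ nb x t := fun x t => mem_iInter₂.2 fun i _ => hVm x i
  obtain ⟨𝒞, h𝒞₀, h𝒞card, h𝒞⟩ := exists_closed_under_operations
    (ι := ι) (J := ι → Set ι × Finset ι)
    (by
      have : #(ι → Set ι × Finset ι) = (2 ^ #ι * #ι) ^ #ι := by simp
      rw [this, mul_eq_left hp (cantor _).le (aleph0_pos.trans_le hι).ne',
        power_two_power_self hι]) ⟨B₀, hB₀⟩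
    (fun c j => avoid (⋃ i, nb (en c (j i).1) (j i).2))
  set G : Set X := ⋃ B ∈ 𝒞, (B : Set X) with hG
  have hGo : IsOpen G := isOpen_biUnion fun B _ => (hB.1 B B.2).1
  have hGn : G.Nonempty := by
    obtain ⟨x, hx⟩ := (hB.1 B₀ hB₀).2
    exact ⟨x, mem_biUnion h𝒞₀ hx⟩
  have hcover : ∀ y : ι → X, (∀ i, y i ∈ closure G) →
      ∃ c : ι → ℬ, (∀ i, c i ∈ 𝒞) ∧ ∀ i, y i ∈ closure (⋃ B ∈ range c, (B : Set X)) := by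
    intro y hy
    have h1 : ∀ i, ∃ f : ι → ℬ, (∀ j, f j ∈ 𝒞) ∧
        y i ∈ closure (⋃ B ∈ range f, (B : Set X)) := by
      intro i
      obtain ⟨C, hCG, hC, hyC⟩ := ht G (y i) (hy i)
      obtain ⟨f, rfl⟩ := exists_range_eq_of_mk_le (closure_nonempty_iff.1 ⟨_, hyC⟩) hC
      have h2 : ∀ j, ∃ B ∈ 𝒞, f j ∈ (B : Set X) := fun j => by
        simpa [hG] using hCG (mem_range_self j)
      choose g hg𝒞 hg using h2
      refine ⟨g, hg𝒞, closure_mono ?_ hyC⟩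
      rintro _ ⟨j, rfl⟩
      exact mem_biUnion (mem_range_self j) (hg j)
    choose f hf𝒞 hf using h1
    obtain ⟨e⟩ : Nonempty (ι ≃ ι × ι) := Cardinal.eq.1 (by simp [mul_eq_self hι])
    refine ⟨fun i => f (e i).1 (e i).2, fun i => hf𝒞 _ _, fun i => closure_mono ?_ (hf i)⟩
    refine biUnion_subset_biUnion_left ?_
    rintro _ ⟨j, rfl⟩
    exact ⟨e.symm (i, j), by simp⟩
  have hclosed : ∀ (y : ι → X) (t : ι → Finset ι), (∀ i, y i ∈ closure G) →
      G ⊆ closure (⋃ i, nb (y i) (t i)) → closure (⋃ i, nb (y i) (t i)) = Set.univ := by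
    intro y t hy hGy
    by_contra hne
    obtain ⟨c, hc𝒞, hcy⟩ := hcover y hy
    choose s hs using fun i => hen c (hcy i)
    have hmem := h𝒞 c hc𝒞 fun i => (s i, t i)
    simp only [hs] at hmem
    obtain ⟨x, hx⟩ := (hB.1 _ (avoid (⋃ i, nb (y i) (t i))).2).2
    exact havoid _ (nonempty_compl.2 hne) hx (hGy (mem_biUnion hmem hx))
  refine ⟨closure G, hUcard 𝒞 h𝒞card, ?_⟩
  by_contra hne
  obtain ⟨x, hx⟩ := (ne_univ_iff_exists_notMem _).1 hne
  simp only [thetaClosure, mem_ofPred_eq, not_forall, not_nonempty_iff_eq_empty] at hx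
  obtain ⟨U, hU, hxU, hUG⟩ := hx
  obtain ⟨B, hBℬ, hBU⟩ := hB.2 U hU ⟨x, hxU⟩
  have hBG : ∀ y ∈ closure G, y ∉ closure B := fun y hy hyB =>
    (hUG ▸ (⟨closure_mono hBU hyB, hy⟩ : y ∈ closure U ∩ closure G) : y ∈ (∅ : Set X))
  obtain ⟨hBo, hBn⟩ := hB.1 B hBℬ
  have hsep : ∀ y : closure G, ∃ t : Finset ι, Disjoint (nb y t) B := fun y =>
    (hc B hBℬ).exists_finset_disjoint hBo (V y) (hVo y) (hV y) (hBG y y.2)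
  choose t hdisj using hsep
  obtain ⟨𝒱, h𝒱, h𝒱card, h𝒱d⟩ := hw (insert (closure G)ᶜ (range fun y : closure G => nb y (t y)))
    ⟨by
      rintro _ (rfl | ⟨y, rfl⟩)
      · exact isClosed_closure.isOpen_compl
      · exact hnbo _ _, by
      refine eq_univ_of_forall fun z => ?_
      by_cases hz : z ∈ closure G
      · exact ⟨_, Or.inr ⟨⟨z, hz⟩, rfl⟩, hnbm _ _⟩
      · exact ⟨_, Or.inl rfl, hz⟩⟩
  let 𝒲 : Set (Set X) := 𝒱 \ {(closure G)ᶜ}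
  have hmeet : ∀ O : Set X, IsOpen O → (O ∩ G).Nonempty → ∃ W ∈ 𝒲, (O ∩ W).Nonempty := by
    intro O hO hOG
    obtain ⟨z, ⟨hzO, hzG⟩, W, hW, hzW⟩ := h𝒱d.inter_open_nonempty _ (hO.inter hGo) hOG
    refine ⟨W, ⟨hW, ?_⟩, z, hzO, hzW⟩
    rintro rfl
    exact hzW (subset_closure hzG)
  obtain ⟨W₀, hW₀, -⟩ := hmeet univ isOpen_univ (by simpa using hGn)
  obtain ⟨w, hwr⟩ := exists_range_eq_of_mk_le (ι := ι) ⟨W₀, hW₀⟩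
    ((mk_le_mk_of_subset sdiff_subset).trans h𝒱card)
  have hw𝒲 : ∀ i, w i ∈ 𝒲 := fun i => hwr ▸ mem_range_self i
  choose y hy using fun i => (h𝒱 (hw𝒲 i).1).resolve_left (hw𝒲 i).2
  have huniv := hclosed (fun i => y i) (fun i => t (y i)) (fun i => (y i).2) (by
    intro g hg
    rw [mem_closure_iff]
    intro O hO hgO
    obtain ⟨W, hW, z, hzO, hzW⟩ := hmeet O hO ⟨g, hgO, hg⟩
    obtain ⟨i, rfl⟩ : W ∈ range w := hwr ▸ hW
    refine ⟨z, hzO, mem_iUnion.2 ⟨i, ?_⟩⟩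
    have := hy i
    simp only at this
    rwa [this])
  obtain ⟨b, hb⟩ := hBn
  obtain ⟨z, hzB, hz⟩ := mem_closure_iff.1 (huniv ▸ mem_univ b) B hBo hb
  obtain ⟨i, hzi⟩ := mem_iUnion.1 hz
  exact (hdisj (y i)).le_bot ⟨hzi, hzB⟩

theorem wLdeg_spec (X : Type u) [TopologicalSpace X] :
    ℵ₀ ≤ wLdeg X ∧ ∀ 𝒰 : Set (Set X), IsOpenCover X 𝒰 →
      ∃ 𝒱 ⊆ 𝒰, #𝒱 ≤ wLdeg X ∧ Dense (⋃₀ 𝒱) :=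
  csInf_mem (s := {κ | ℵ₀ ≤ κ ∧ ∀ 𝒰 : Set (Set X), IsOpenCover X 𝒰 →
    ∃ 𝒱 ⊆ 𝒰, #𝒱 ≤ κ ∧ Dense (⋃₀ 𝒱)})
    ⟨max ℵ₀ #(Set X), le_max_left _ _, fun 𝒰 h𝒰 =>
      ⟨𝒰, Subset.rfl, (mk_set_le _).trans (le_max_right _ _), h𝒰.2 ▸ dense_univ⟩⟩

theorem tightness_spec (X : Type u) [TopologicalSpace X] :
    ℵ₀ ≤ tightness X ∧ ∀ (A : Set X) (x : X), x ∈ closure A →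
      ∃ B ⊆ A, #B ≤ tightness X ∧ x ∈ closure B :=
  csInf_mem (s := {κ | ℵ₀ ≤ κ ∧ ∀ (A : Set X) (x : X), x ∈ closure A →
    ∃ B ⊆ A, #B ≤ κ ∧ x ∈ closure B})
    ⟨max ℵ₀ #X, le_max_left _ _, fun A _ hx =>
      ⟨A, Subset.rfl, (mk_set_le _).trans (le_max_right _ _), hx⟩⟩

theorem closedPseudoChar_spec (X : Type u) [TopologicalSpace X] [T2Space X] :
    ℵ₀ ≤ closedPseudoChar X ∧ ∀ x : X, ∃ 𝒱 : Set (Set X), #𝒱 ≤ closedPseudoChar X ∧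
      (∀ V ∈ 𝒱, IsOpen V ∧ x ∈ V) ∧ (⋂ V ∈ 𝒱, closure V) = {x} :=
  csInf_mem (s := {κ | ℵ₀ ≤ κ ∧ ∀ x : X, ∃ 𝒱 : Set (Set X), #𝒱 ≤ κ ∧
    (∀ V ∈ 𝒱, IsOpen V ∧ x ∈ V) ∧ (⋂ V ∈ 𝒱, closure V) = {x}})
    ⟨max ℵ₀ #(Set X), le_max_left _ _, fun x =>
      ⟨{V | IsOpen V ∧ x ∈ V}, (mk_set_le _).trans (le_max_right _ _), fun _ hV => hV, by
        refine Subset.antisymm (fun y hy => ?_) ?_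
        · by_contra hyx
          obtain ⟨U, V, hU, hV, hxU, hyV, hUV⟩ := t2_separation (Ne.symm hyx)
          exact (hUV.closure_left hV).le_bot ⟨mem_iInter₂.1 hy U ⟨hU, hxU⟩, hyV⟩
        · rintro _ rfl
          exact mem_iInter₂.2 fun V hV => subset_closure hV.2⟩⟩

theorem stmt19 (X : Type u) [TopologicalSpace X] [T2Space X] (ℬ : Set (Set X))
    (hB : IsPiBase X ℬ) (hc : ∀ B ∈ ℬ, IsHClosedSpace ↥(closure B)) :
    thetaDensityCard X ≤ 2 ^ (closedPseudoChar X * tightness X * wLdeg X) := by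
  obtain ⟨hψ, hψ'⟩ := closedPseudoChar_spec X
  obtain ⟨hτ, hτ'⟩ := tightness_spec X
  obtain ⟨hl, hl'⟩ := wLdeg_spec X
  have hψ0 := (aleph0_pos.trans_le hψ).ne'
  have hτ0 := (aleph0_pos.trans_le hτ).ne'
  have hl0 := (aleph0_pos.trans_le hl).ne'
  set κ := closedPseudoChar X * tightness X * wLdeg X with hκ
  have hle : closedPseudoChar X * tightness X ≤ κ := le_mul_right hl0
  have hψκ : closedPseudoChar X ≤ κ := (le_mul_right hτ0).trans hle
  have hτκ : tightness X ≤ κ := (le_mul_left hψ0).trans hle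
  have hlκ : wLdeg X ≤ κ := le_mul_left (mul_ne_zero hψ0 hτ0)
  clear_value κ
  obtain ⟨ι, rfl⟩ : ∃ ι : Type u, #ι = κ := ⟨κ.out, mk_out κ⟩
  have hι : ℵ₀ ≤ #ι := hψ.trans hψκ
  have : Infinite ι := infinite_iff.2 hι
  have hV : ∀ x : X, ∃ V : ι → Set X, (∀ i, IsOpen (V i)) ∧ (∀ i, x ∈ V i) ∧
      ∀ y, (∀ i, y ∈ closure (V i)) → y = x := by
    intro x
    obtain ⟨𝒱, hcard, h𝒱, hx⟩ := hψ' x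
    obtain ⟨V, hV⟩ := exists_range_eq_of_mk_le (ι := ι) (A := insert Set.univ 𝒱) (insert_nonempty _ _)
      (mk_insert_le.trans (add_le_of_le hι (hcard.trans hψκ) (one_le_aleph0.trans hι)))
    have hV' : ∀ i, IsOpen (V i) ∧ x ∈ V i := by
      intro i
      rcases (hV ▸ mem_range_self i : V i ∈ insert Set.univ 𝒱) with h | h
      · simp [h]
      · exact h𝒱 _ h
    refine ⟨V, fun i => (hV' i).1, fun i => (hV' i).2, fun y hy => ?_⟩
    have hy' : y ∈ ⋂ W ∈ 𝒱, closure W := mem_iInter₂.2 fun W hW => by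
      obtain ⟨i, rfl⟩ : W ∈ range V := hV ▸ mem_insert_of_mem _ hW
      exact hy i
    rwa [hx] at hy'
  choose V hVo hVm hV using hV
  obtain ⟨D, hD, hD'⟩ := exists_thetaClosure_eq_univ hB hc V hVo hVm hV
    (fun A x hx => by
      obtain ⟨B, hBA, hBc, hxB⟩ := hτ' A x hx
      exact ⟨B, hBA, hBc.trans hτκ, hxB⟩)
    (fun 𝒰 h𝒰 => by
      obtain ⟨𝒱, h𝒱, hcard, hd⟩ := hl' 𝒰 h𝒰
      exact ⟨𝒱, h𝒱, hcard.trans hlκ, hd⟩)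
  exact csInf_le' ⟨hι.trans (cantor _).le, D, hD, hD'⟩
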